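/- Let E(s) denote the expectation under the uniform distribution on Dyck paths x of length 2s of the quantity Σ_{t_1 ≤ 2s} r_1(t_1), where r_1(t_1) = max{ r : x(t) ≥ x(t_1) for all t ∈ [t_1, t_1 + r] }. Then there exists a constant C such that E(s) ≤ C·s^{3/2} for all s ≥ 1. -/

import Mathlib

open Finset

/-- The height function of a `±1` step sequence `f : Fin (2s) → Bool`. -/
def walkHeight (s : ℕ) (f : Fin (2 * s) → Bool) (t : ℕ) : ℤ :=
  ∑ j : Fin (2 * s), if (j : ℕ) < t then (if f j then (1 : ℤ) else -1) else 0

/-- The finite set of Dyck paths of length `2s`, encoded by their step sequences. -/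
def dyckSet (s : ℕ) : Finset (Fin (2 * s) → Bool) :=
  Finset.univ.filter fun f =>
    walkHeight s f (2 * s) = 0 ∧ ∀ t ≤ 2 * s, 0 ≤ walkHeight s f t

/-- `r1 f t1` : the largest `r` with `t1 + r ≤ 2s` such that the trajectory stays at or
above level `x(t1)` on `[t1, t1 + r]`. -/
def dyckR1 (s : ℕ) (f : Fin (2 * s) → Bool) (t1 : ℕ) : ℕ :=
  ((Finset.range (2 * s + 1)).filter fun r => t1 + r ≤ 2 * s ∧
    ∀ t ∈ Finset.Icc t1 (t1 + r), walkHeight s f t1 ≤ walkHeight s f t).sup id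

/-- The number of `±1` walks of length `n` with displacement `x`. -/
def walkCount : ℕ → ℤ → ℤ
  | 0, x => if x = 0 then 1 else 0
  | n + 1, x => walkCount n (x + 1) + walkCount n (x - 1)

/-- The number of `±1` walks of length `n` with displacement at least `x`, plus the number of
those with displacement greater than `x`. -/
def walkTail : ℕ → ℤ → ℤ
  | 0, x => if x < 0 then 2 else if x = 0 then 1 else 0
  | n + 1, x => walkTail n (x + 1) + walkTail n (x - 1)

theorem walkCount_succ (n : ℕ) (x : ℤ) :
    walkCount (n + 1) x = walkCount n (x + 1) + walkCount n (x - 1) := rfl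

theorem walkCount_neg (n : ℕ) (x : ℤ) : walkCount n (-x) = walkCount n x := by
  induction n generalizing x with
  | zero => simp [walkCount]
  | succ n ih =>
    rw [walkCount, walkCount, ← ih (x + 1), ← ih (x - 1), add_comm]
    congr 2 <;> ring

theorem walkCount_eq_zero_of_lt (n : ℕ) (x : ℤ) (h : (n : ℤ) < x) : walkCount n x = 0 := by
  induction n generalizing x with
  | zero => simp only [walkCount]; split_ifs <;> grind
  | succ n ih =>
    push_cast at h
    rw [walkCount, ih _ (by linarith), ih _ (by linarith), add_zero]

theorem walkCount_eq_choose (n k : ℕ) : walkCount n (n - 2 * k) = n.choose k := by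
  induction n generalizing k with
  | zero => cases k with
    | zero => simp [walkCount]
    | succ k => simp only [walkCount, Nat.choose_zero_succ]; split_ifs <;> grind
  | succ n ih =>
    cases k with
    | zero =>
      have := ih 0
      rw [walkCount, walkCount_eq_zero_of_lt _ _ (by push_cast; linarith)]
      simpa using this
    | succ k =>
      rw [walkCount, Nat.choose_succ_succ, Nat.cast_add (n.choose k), ← ih, ← ih]
      push_cast
      congr 2 <;> ring

theorem walkTail_nonneg (n : ℕ) (x : ℤ) : 0 ≤ walkTail n x := by
  induction n generalizing x with
  | zero => simp only [walkTail]; split_ifs <;> norm_num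
  | succ n ih => exact add_nonneg (ih _) (ih _)

theorem walkTail_le (n : ℕ) (x : ℤ) : walkTail n x ≤ 2 * 2 ^ n := by
  induction n generalizing x with
  | zero => simp only [walkTail]; split_ifs <;> norm_num
  | succ n ih =>
    rw [walkTail, pow_succ]
    linarith [ih (x + 1), ih (x - 1)]

theorem walkCount_succ_le_walkTail_sub (n : ℕ) (x : ℤ) :
    walkCount (n + 1) x ≤ walkTail n (x - 1) - walkTail n (x + 1) := by
  induction n generalizing x with
  | zero => simp only [walkTail, walkCount]; split_ifs <;> grind
  | succ n ih =>
    have h1 := ih (x + 1)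
    have h2 := ih (x - 1)
    rw [walkCount, walkTail, walkTail]
    simp only [sub_add_cancel, add_sub_cancel_right] at *
    linarith

/-- The displacement after `t` steps of a `±1` walk of length `n`. -/
def walkDisp (n : ℕ) (f : Fin n → Bool) (t : ℕ) : ℤ :=
  ∑ j : Fin n, if (j : ℕ) < t then (if f j then (1 : ℤ) else -1) else 0

theorem walkDisp_zero (n : ℕ) (f : Fin n → Bool) : walkDisp n f 0 = 0 := by
  simp [walkDisp]

theorem walkDisp_cons_succ (n : ℕ) (b : Bool) (f : Fin n → Bool) (t : ℕ) :
    walkDisp (n + 1) (Fin.cons b f : Fin (n + 1) → Bool) (t + 1) =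
      (if b then 1 else -1) + walkDisp n f t := by
  simp [walkDisp, Fin.sum_univ_succ]

/-- The walks of length `n` from height `h` to `0` that stay nonnegative. -/
def walkPaths (n : ℕ) (h : ℤ) : Finset (Fin n → Bool) :=
  Finset.univ.filter fun f => h + walkDisp n f n = 0 ∧ ∀ t ≤ n, 0 ≤ h + walkDisp n f t

theorem walkPaths_neg (n : ℕ) {h : ℤ} (hh : h < 0) : walkPaths n h = ∅ := by
  rw [walkPaths, Finset.filter_eq_empty_iff]
  rintro f - ⟨-, h0⟩
  have := h0 0 (Nat.zero_le _)
  rw [walkDisp_zero] at this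
  linarith

theorem cons_mem_walkPaths (n : ℕ) {h : ℤ} (hh : 0 ≤ h) (b : Bool) (f : Fin n → Bool) :
    (Fin.cons b f : Fin (n + 1) → Bool) ∈ walkPaths (n + 1) h ↔
      f ∈ walkPaths n (h + if b then 1 else -1) := by
  simp only [walkPaths, Finset.mem_filter, Finset.mem_univ, true_and, walkDisp_cons_succ,
    add_assoc]
  refine and_congr_right fun _ => ⟨fun H t ht => ?_, fun H t ht => ?_⟩
  · simpa only [walkDisp_cons_succ] using H (t + 1) (by omega)
  · cases t with
    | zero => simpa only [walkDisp_zero, add_zero] using hh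
    | succ t => simpa only [walkDisp_cons_succ] using H t (by omega)

theorem sum_walkPaths_succ (n : ℕ) {h : ℤ} (hh : 0 ≤ h) (F : (Fin (n + 1) → Bool) → ℤ) :
    ∑ f ∈ walkPaths (n + 1) h, F f =
      ∑ f ∈ walkPaths n (h + 1), F (Fin.cons true f : Fin (n + 1) → Bool) +
        ∑ f ∈ walkPaths n (h - 1), F (Fin.cons false f : Fin (n + 1) → Bool) := by
  have key : ∀ m k (G : (Fin m → Bool) → ℤ), ∑ f ∈ walkPaths m k, G f =
      ∑ f, if f ∈ walkPaths m k then G f else 0 := by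
    intro m k G
    rw [← Finset.sum_filter]
    congr 1
    ext; simp
  rw [key, key, key, ← (Fin.consEquiv fun _ : Fin (n + 1) => Bool).sum_comp,
    Fintype.sum_prod_type, Fintype.sum_bool]
  simp only [Fin.consEquiv, Equiv.coe_fn_mk, cons_mem_walkPaths n hh, if_true, sub_eq_add_neg,
    Bool.false_eq_true, if_false]

theorem card_walkPaths (n : ℕ) {h : ℤ} (hh : -1 ≤ h) :
    ((walkPaths n h).card : ℤ) = walkCount n h - walkCount n (h + 2) := by
  induction n generalizing h with
  | zero =>
    by_cases h0 : h = 0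
    · subst h0
      simp [walkPaths, walkDisp, walkCount]
    · have : walkPaths 0 h = ∅ := by
        simp [walkPaths, walkDisp, h0]
      rw [this]
      simp only [walkCount]
      split_ifs <;> grind
  | succ n ih =>
    rcases hh.eq_or_lt with rfl | hlt
    · rw [walkPaths_neg _ (by norm_num), walkCount_neg]
      norm_num
    · have h0 : 0 ≤ h := by omega
      have := sum_walkPaths_succ n h0 fun _ => 1
      simp only [Finset.sum_const, nsmul_eq_mul, mul_one] at this
      rw [this, ih (by linarith), ih (by linarith), walkCount, walkCount]
      ring_nf

/-- The number of times `k ≤ n` such that the walk started from `c` is nonnegative up to `k`. -/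
def stayCount (n : ℕ) (c : ℤ) (f : Fin n → Bool) : ℕ :=
  ((Finset.range (n + 1)).filter fun k => ∀ t ≤ k, 0 ≤ c + walkDisp n f t).card

theorem stayCount_neg (n : ℕ) {c : ℤ} (hc : c < 0) (f : Fin n → Bool) : stayCount n c f = 0 := by
  rw [stayCount, Finset.card_eq_zero, Finset.filter_eq_empty_iff]
  intro k _ h0
  have := h0 0 (Nat.zero_le _)
  rw [walkDisp_zero] at this
  linarith

theorem stayCount_cons (n : ℕ) {c : ℤ} (hc : 0 ≤ c) (b : Bool) (f : Fin n → Bool) :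
    stayCount (n + 1) c (Fin.cons b f : Fin (n + 1) → Bool) =
      1 + stayCount n (c + if b then 1 else -1) f := by
  have key : ∀ k, (∀ t ≤ k + 1, 0 ≤ c + walkDisp (n + 1) (Fin.cons b f : Fin (n + 1) → Bool) t) ↔
      ∀ t ≤ k, 0 ≤ (c + if b then 1 else -1) + walkDisp n f t := by
    refine fun k => ⟨fun H t ht => ?_, fun H t ht => ?_⟩
    · simpa only [walkDisp_cons_succ, add_assoc] using H (t + 1) (by omega)
    · cases t with
      | zero => simpa only [walkDisp_zero, add_zero] using hc
      | succ t => simpa only [walkDisp_cons_succ, add_assoc] using H t (by omega)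
  simp only [stayCount, Finset.card_filter]
  rw [Finset.sum_range_succ' _ (n + 1), add_comm]
  simp only [key]
  simp [walkDisp_zero, hc]

theorem sum_stayCount (n : ℕ) {h c : ℤ} (hc : -1 ≤ c) (hch : c ≤ h) :
    ∑ f ∈ walkPaths n h, (stayCount n c f : ℤ) = (c + 1) * walkCount (n + 1) (h + 1) := by
  induction n generalizing h c with
  | zero =>
    rcases hc.eq_or_lt with rfl | hlt
    · simp [stayCount_neg]
    have hc0 : 0 ≤ c := by omega
    have hs : ∀ f : Fin 0 → Bool, stayCount 0 c f = 1 := fun f => by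
      simp [stayCount, walkDisp, hc0]
    simp only [hs, Nat.cast_one, Finset.sum_const, nsmul_eq_mul, mul_one,
      card_walkPaths 0 (hc.trans hch)]
    simp only [walkCount]
    split_ifs <;> grind
  | succ n ih =>
    rcases hc.eq_or_lt with rfl | hlt
    · simp [stayCount_neg]
    have hc0 : 0 ≤ c := by omega
    have hA := card_walkPaths (n + 1) (hc.trans hch)
    have hA' := sum_walkPaths_succ n (hc0.trans hch) fun _ => 1
    simp only [Finset.sum_const, nsmul_eq_mul, mul_one] at hA'
    rw [sum_walkPaths_succ n (hc0.trans hch)]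
    simp only [stayCount_cons n hc0, if_true, Bool.false_eq_true, if_false, Nat.cast_add,
      Nat.cast_one, Finset.sum_add_distrib, Finset.sum_const, nsmul_eq_mul, mul_one,
      ← sub_eq_add_neg]
    rw [ih (by linarith) (by linarith), ih (by linarith) (by linarith), walkCount_succ (n + 1)]
    rw [show h + 1 + 1 = h + 2 by ring, show h + 1 - 1 = h by ring, sub_add_cancel c,
      sub_add_cancel h]
    linarith

/-- The largest `r` with `t₁ + r ≤ n` such that the walk stays at or above its value at `t₁`
on `[t₁, t₁ + r]`. -/
def stayLength (n : ℕ) (f : Fin n → Bool) (t1 : ℕ) : ℕ :=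
  ((Finset.range (n + 1)).filter fun r => t1 + r ≤ n ∧
    ∀ t ∈ Finset.Icc t1 (t1 + r), walkDisp n f t1 ≤ walkDisp n f t).sup id

theorem stayLength_zero_lt (n : ℕ) (f : Fin n → Bool) : stayLength n f 0 < stayCount n 0 f := by
  have hpos : 0 < stayCount n 0 f := by
    rw [stayCount, Finset.card_pos]
    exact ⟨0, by simp [walkDisp_zero]⟩
  rw [stayLength, Finset.sup_lt_iff hpos]
  intro r hr
  simp only [Finset.mem_filter, Finset.mem_range, Finset.mem_Icc, zero_add, walkDisp_zero] at hr
  rw [id, Nat.lt_iff_add_one_le, ← Finset.card_range (r + 1), stayCount]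
  refine Finset.card_le_card fun k hk => ?_
  simp only [Finset.mem_filter, Finset.mem_range, zero_add] at hk ⊢
  exact ⟨by omega, fun t ht => hr.2.2 t ⟨Nat.zero_le _, by omega⟩⟩

theorem stayLength_cons_succ_le (n : ℕ) (b : Bool) (f : Fin n → Bool) (t : ℕ) :
    stayLength (n + 1) (Fin.cons b f : Fin (n + 1) → Bool) (t + 1) ≤ stayLength n f t := by
  rw [stayLength, stayLength]
  refine Finset.sup_mono fun r hr => ?_
  simp only [Finset.mem_filter, Finset.mem_range, Finset.mem_Icc] at hr ⊢
  refine ⟨by omega, by omega, fun u hu => ?_⟩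
  have := hr.2.2 (u + 1) (by omega)
  simpa only [walkDisp_cons_succ, add_le_add_iff_left] using this

theorem sum_stayLength_le (n : ℕ) {h : ℤ} (hh : -1 ≤ h) :
    ∑ f ∈ walkPaths n h, ∑ t ∈ Finset.range (n + 1), (stayLength n f t : ℤ) ≤
      2 * (h + 1) * walkTail n (h + 2) := by
  induction n generalizing h with
  | zero =>
    have hz : ∀ f : Fin 0 → Bool, stayLength 0 f 0 = 0 := fun f => by
      rw [← Nat.le_zero]
      exact Finset.sup_le fun r hr => by
        simp only [Finset.mem_filter, Finset.mem_range] at hr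
        simp only [id]; omega
    simp only [zero_add, Finset.sum_range_one, hz, Nat.cast_zero, Finset.sum_const_zero]
    exact mul_nonneg (by linarith) (walkTail_nonneg _ _)
  | succ n ih =>
    rcases hh.eq_or_lt with rfl | hlt
    · simp [walkPaths_neg]
    have h0 : 0 ≤ h := by omega
    have hR : ∑ f ∈ walkPaths (n + 1) h, (stayLength (n + 1) f 0 : ℤ) ≤
        2 * walkCount (n + 1) (h + 2) := by
      have h1 : ∑ f ∈ walkPaths (n + 1) h, ((stayLength (n + 1) f 0 : ℤ) + 1) ≤
          ∑ f ∈ walkPaths (n + 1) h, (stayCount (n + 1) 0 f : ℤ) :=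
        Finset.sum_le_sum fun f _ => by exact_mod_cast stayLength_zero_lt (n + 1) f
      rw [sum_stayCount (n + 1) (by norm_num) h0, Finset.sum_add_distrib, Finset.sum_const,
        nsmul_eq_mul, mul_one, card_walkPaths _ hh, walkCount_succ (n + 1),
        show h + 1 + 1 = h + 2 by ring, show h + 1 - 1 = h by ring] at h1
      linarith
    have hT : ∀ b : Bool, ∀ k : ℤ,
        ∑ f ∈ walkPaths n k, ∑ t ∈ Finset.range (n + 1),
          (stayLength (n + 1) (Fin.cons b f : Fin (n + 1) → Bool) (t + 1) : ℤ) ≤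
        ∑ f ∈ walkPaths n k, ∑ t ∈ Finset.range (n + 1), (stayLength n f t : ℤ) :=
      fun b k => Finset.sum_le_sum fun f _ => Finset.sum_le_sum fun t _ => by
        exact_mod_cast stayLength_cons_succ_le n b f t
    simp only [Finset.sum_range_succ' _ (n + 1), Finset.sum_add_distrib]
    rw [sum_walkPaths_succ n h0 fun f =>
      ∑ t ∈ Finset.range (n + 1), (stayLength (n + 1) f (t + 1) : ℤ)]
    have hN := walkCount_succ_le_walkTail_sub n (h + 2)
    have i1 := (hT true _).trans (ih (h := h + 1) (by linarith))
    have i2 := (hT false _).trans (ih (h := h - 1) (by linarith))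
    rw [walkTail]
    rw [show h + 1 + 2 = h + 2 + 1 by ring] at i1
    rw [show h - 1 + 2 = h + 2 - 1 by ring] at i2
    linarith

theorem walkPaths_zero_eq_dyckSet (s : ℕ) : walkPaths (2 * s) 0 = dyckSet s := by
  simp only [walkPaths, zero_add]
  rfl

theorem succ_mul_card_dyckSet (s : ℕ) : (s + 1) * (dyckSet s).card = s.centralBinom := by
  have h1 := card_walkPaths (2 * s) (h := 0) (by norm_num)
  have h2 := walkCount_eq_choose (2 * s) s
  have h3 := walkCount_eq_choose (2 * s) (s + 1)
  rw [show ((2 * s : ℕ) : ℤ) - 2 * s = 0 by push_cast; ring] at h2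
  rw [show ((2 * s : ℕ) : ℤ) - 2 * (s + 1 : ℕ) = -2 by push_cast; ring, walkCount_neg] at h3
  have h4 := Nat.choose_succ_right_eq (2 * s) s
  rw [show 2 * s - s = s by omega] at h4
  rw [walkPaths_zero_eq_dyckSet, zero_add, h2, h3] at h1
  zify at h4 ⊢
  rw [h1, Nat.centralBinom]
  linarith

theorem four_pow_sq_le (s : ℕ) (hs : 1 ≤ s) : (4 ^ s) ^ 2 ≤ 4 * s * s.centralBinom ^ 2 := by
  induction s, hs using Nat.le_induction with
  | base => simp [Nat.centralBinom]
  | succ n hn ih =>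
    have h := Nat.succ_mul_centralBinom_succ n
    refine Nat.le_of_mul_le_mul_left (c := n + 1) ?_ n.succ_pos
    calc (n + 1) * (4 ^ (n + 1)) ^ 2 = 16 * (n + 1) * (4 ^ n) ^ 2 := by ring
      _ ≤ 16 * (n + 1) * (4 * n * n.centralBinom ^ 2) := by gcongr
      _ = 16 * (4 * n * (n + 1)) * n.centralBinom ^ 2 := by ring
      _ ≤ 16 * (2 * n + 1) ^ 2 * n.centralBinom ^ 2 := by gcongr; nlinarith
      _ = 4 * (2 * (2 * n + 1) * n.centralBinom) ^ 2 := by ring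
      _ = (n + 1) * (4 * (n + 1) * (n + 1).centralBinom ^ 2) := by rw [← h]; ring

theorem sum_dyckR1_le (s : ℕ) :
    ∑ f ∈ dyckSet s, ∑ t1 ∈ Finset.range (2 * s + 1), (dyckR1 s f t1 : ℝ) ≤ 4 * 4 ^ s := by
  have h1 := sum_stayLength_le (2 * s) (h := 0) (by norm_num)
  have h2 := walkTail_le (2 * s) (0 + 2)
  rw [walkPaths_zero_eq_dyckSet] at h1
  have h3 : ∑ f ∈ dyckSet s, ∑ t1 ∈ Finset.range (2 * s + 1), (dyckR1 s f t1 : ℤ) ≤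
      4 * 4 ^ s := by
    rw [pow_mul] at h2
    norm_num at h2
    refine le_trans (b := 2 * (0 + 1) * walkTail (2 * s) (0 + 2)) h1 ?_
    norm_num
    linarith
  exact_mod_cast h3

/-- Under the uniform distribution on Dyck paths of length `2s`, the expectation of
`∑_{t1 ≤ 2s} r1(t1)` is at most `C · s^{3/2}` for a universal constant `C > 0`. -/
theorem dyck_expectation_bound :
    ∃ C : ℝ, 0 < C ∧ ∀ s : ℕ, 1 ≤ s →
      (∑ f ∈ dyckSet s, ∑ t1 ∈ Finset.range (2 * s + 1), (dyckR1 s f t1 : ℝ)) /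
          ((dyckSet s).card : ℝ)
        ≤ C * (s : ℝ) ^ (3 / 2 : ℝ) := by
  refine ⟨16, by norm_num, fun s hs => ?_⟩
  have hc : ((s : ℝ) + 1) * (dyckSet s).card = s.centralBinom := by
    exact_mod_cast succ_mul_card_dyckSet s
  have hs1 : (1 : ℝ) ≤ s := by exact_mod_cast hs
  have hcb : (0 : ℝ) < s.centralBinom := by exact_mod_cast s.centralBinom_pos
  have hcard : (0 : ℝ) < (dyckSet s).card := by
    rw [← hc] at hcb
    exact pos_of_mul_pos_right hcb (by positivity)
  have h4 : (4 : ℝ) ^ s ≤ 2 * √s * s.centralBinom := by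
    refine le_of_sq_le_sq ?_ (by positivity)
    rw [mul_pow, mul_pow, Real.sq_sqrt (by positivity)]
    have := four_pow_sq_le s hs
    norm_num
    exact_mod_cast this
  have hpow : (s : ℝ) ^ (3 / 2 : ℝ) = s * √s := by
    rw [show (3 / 2 : ℝ) = 1 + 1 / 2 by norm_num, Real.rpow_add (by linarith), Real.rpow_one,
      ← Real.sqrt_eq_rpow]
  rw [div_le_iff₀ hcard, hpow]
  calc _ ≤ 4 * (4 : ℝ) ^ s := sum_dyckR1_le s
    _ ≤ 4 * (2 * √s * s.centralBinom) := by gcongr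
    _ = 8 * (s + 1) * (√s * (dyckSet s).card) := by rw [← hc]; ring
    _ ≤ 8 * (s + s) * (√s * (dyckSet s).card) := by gcongr
    _ = 16 * (s * √s) * (dyckSet s).card := by ring
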